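/- Let F = (P,Q) be a polynomial automorphism of ℂ² with deg P > 1 and deg P = m · deg Q for some positive integer m. Then there exists a constant c ∈ ℂ such that deg(P − c·Q^m) < deg P. -/

import Mathlib

open MvPolynomial

/-- `(P, Q)` is a polynomial automorphism of ℂ²: the polynomial map
`F(x,y) = (P(x,y), Q(x,y))` admits a polynomial inverse `(P', Q')`. -/
def IsPolyAut (P Q : MvPolynomial (Fin 2) ℂ) : Prop :=
  ∃ P' Q' : MvPolynomial (Fin 2) ℂ,
    (∀ v : Fin 2 → ℂ,
      eval ![eval v P, eval v Q] P' = v 0 ∧ eval ![eval v P, eval v Q] Q' = v 1) ∧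
    (∀ v : Fin 2 → ℂ,
      eval ![eval v P', eval v Q'] P = v 0 ∧ eval ![eval v P', eval v Q'] Q = v 1)

namespace MvPolynomial

variable {σ R : Type*} [CommRing R]

theorem pderiv_bind₁ {τ : Type*} [Fintype σ] (f : σ → MvPolynomial τ R) (p : MvPolynomial σ R)
    (i : τ) :
    pderiv i (bind₁ f p) = ∑ j, bind₁ f (pderiv j p) * pderiv i (f j) := by
  classical
  induction p using MvPolynomial.induction_on with
  | C a => simp
  | add p q hp hq => simp [hp, hq, add_mul, Finset.sum_add_distrib]
  | mul_X p k hp =>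
    simp only [map_mul, bind₁_X_right, pderiv_mul, hp, map_add, add_mul, Finset.sum_add_distrib,
      pderiv_X, Finset.sum_mul]
    congr 1
    · exact Finset.sum_congr rfl fun j _ => by ring
    · rw [Finset.sum_eq_single k]
      · simp
      · intro j _ hj
        simp [Pi.single_eq_of_ne hj.symm]
      · simp

theorem coeff_X_mul_pderiv (i : σ) (f : MvPolynomial σ R) (d : σ →₀ ℕ) :
    coeff d (X i * pderiv i f) = d i * coeff d f := by
  classical
  rw [coeff_X_mul']
  split_ifs with h
  · have h1 : 1 ≤ d i := Nat.one_le_iff_ne_zero.mpr (Finsupp.mem_support_iff.mp h)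
    rw [coeff_pderiv, tsub_add_cancel_of_le (Finsupp.single_le_iff.mpr h1)]
    simp only [Finsupp.tsub_apply, Finsupp.single_eq_same]
    push_cast [h1]
    ring
  · simp [Finsupp.notMem_support_iff.mp h]

theorem homogeneousComponent_pderiv (i : σ) (n : ℕ) (f : MvPolynomial σ R) :
    homogeneousComponent n (pderiv i f) = pderiv i (homogeneousComponent (n + 1) f) := by
  classical
  ext d
  simp only [coeff_homogeneousComponent, coeff_pderiv, map_add, Finsupp.degree_single,
    add_left_inj, ite_mul, zero_mul]

theorem totalDegree_pderiv_le {n : ℕ} (i : σ) {f : MvPolynomial σ R}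
    (hf : f.totalDegree ≤ n + 1) : (pderiv i f).totalDegree ≤ n := by
  refine Finset.sup_le fun d hd => ?_
  rw [mem_support_iff, coeff_pderiv] at hd
  have h := le_totalDegree (mem_support_iff.mpr (left_ne_zero_of_mul hd))
  change (d + Finsupp.single i 1).degree ≤ _ at h
  rw [map_add, Finsupp.degree_single] at h
  change d.degree ≤ n
  omega

theorem homogeneousComponent_mul_of_totalDegree_le {a b : ℕ} {f g : MvPolynomial σ R}
    (hf : f.totalDegree ≤ a) (hg : g.totalDegree ≤ b) :
    homogeneousComponent (a + b) (f * g) =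
      homogeneousComponent a f * homogeneousComponent b g := by
  classical
  ext d
  rw [coeff_homogeneousComponent, coeff_mul, coeff_mul]
  trans ∑ x ∈ Finset.HasAntidiagonal.antidiagonal d,
      if d.degree = a + b then coeff x.1 f * coeff x.2 g else 0
  · split_ifs <;> simp
  refine Finset.sum_congr rfl fun x hx => ?_
  have hd : x.1.degree + x.2.degree = d.degree := by
    rw [← map_add, Finset.HasAntidiagonal.mem_antidiagonal.mp hx]
  have hf' (h : a < x.1.degree) : coeff x.1 f = 0 :=
    coeff_eq_zero_of_totalDegree_lt (hf.trans_lt h)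
  have hg' (h : b < x.2.degree) : coeff x.2 g = 0 :=
    coeff_eq_zero_of_totalDegree_lt (hg.trans_lt h)
  simp only [coeff_homogeneousComponent]
  grind

theorem homogeneousComponent_pow_of_totalDegree_le {a : ℕ} {f : MvPolynomial σ R}
    (hf : f.totalDegree ≤ a) (m : ℕ) :
    homogeneousComponent (m * a) (f ^ m) = homogeneousComponent a f ^ m := by
  induction m with
  | zero => simp
  | succ m ih =>
    rw [pow_succ, pow_succ, add_mul, one_mul, homogeneousComponent_mul_of_totalDegree_le _ hf, ih]
    exact (totalDegree_pow f m).trans (Nat.mul_le_mul_left m hf)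

theorem totalDegree_lt_of_homogeneousComponent_eq_zero {n : ℕ} {f : MvPolynomial σ R}
    (hn : 0 < n) (hf : f.totalDegree ≤ n) (h : homogeneousComponent n f = 0) :
    f.totalDegree < n := by
  refine (Finset.sup_lt_iff hn).mpr fun d hd => ?_
  refine lt_of_le_of_ne ((le_totalDegree hd).trans hf) fun (hdn : d.degree = n) => ?_
  have hc : coeff d (homogeneousComponent n f) = coeff d f := by
    rw [coeff_homogeneousComponent, if_pos hdn]
  rw [h, coeff_zero] at hc
  exact mem_support_iff.mp hd hc.symm

theorem homogeneousComponent_totalDegree_ne_zero {f : MvPolynomial σ R}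
    (hf : 0 < f.totalDegree) : homogeneousComponent f.totalDegree f ≠ 0 := fun h =>
  (totalDegree_lt_of_homogeneousComponent_eq_zero hf le_rfl h).false

/-- If the logarithmic derivatives of `f` and `g` agree, their leading monomials agree. -/
theorem degree_eq_of_pderiv_mul_eq [IsDomain R] [CharZero R] (μ : MonomialOrder σ)
    {f g : MvPolynomial σ R} (hf : f ≠ 0) (hg : g ≠ 0)
    (h : ∀ i, pderiv i f * g = f * pderiv i g) : μ.degree f = μ.degree g := by
  have hle (i : σ) (f : MvPolynomial σ R) :
      μ.toSyn (μ.degree (X i * pderiv i f)) ≤ μ.toSyn (μ.degree f) := by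
    refine μ.degree_le_iff.mpr fun c hc => μ.le_degree ?_
    rw [mem_support_iff, coeff_X_mul_pderiv] at hc
    exact mem_support_iff.mpr (right_ne_zero_of_mul hc)
  ext i
  have hi : (X i * pderiv i f) * g = f * (X i * pderiv i g) := by
    linear_combination X i * h i
  have hc := congrArg (coeff (μ.degree f + μ.degree g)) hi
  rw [μ.coeff_mul_of_add_of_degree_le (hle i f) le_rfl,
    μ.coeff_mul_of_add_of_degree_le le_rfl (hle i g), coeff_X_mul_pderiv, coeff_X_mul_pderiv] at hc
  have hne : coeff (μ.degree f) f * coeff (μ.degree g) g ≠ 0 :=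
    mul_ne_zero (μ.coeff_degree_ne_zero_iff.mpr hf) (μ.coeff_degree_ne_zero_iff.mpr hg)
  have : ((μ.degree f i : ℕ) : R) = (μ.degree g i : ℕ) :=
    mul_right_cancel₀ hne (by linear_combination hc)
  exact_mod_cast this

/-- Polynomials over a field of characteristic zero whose quotient has vanishing derivatives
are proportional. -/
theorem exists_eq_C_mul_of_pderiv_mul_eq {K : Type*} [Field K] [CharZero K] [LinearOrder σ]
    [WellFoundedGT σ] {f g : MvPolynomial σ K} (hg : g ≠ 0)
    (h : ∀ i, pderiv i f * g = f * pderiv i g) : ∃ c : K, f = C c * g := by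
  let μ : MonomialOrder σ := MonomialOrder.lex
  have hg' : coeff (μ.degree g) g ≠ 0 := μ.coeff_degree_ne_zero_iff.mpr hg
  refine ⟨coeff (μ.degree g) f / coeff (μ.degree g) g, ?_⟩
  set c := coeff (μ.degree g) f / coeff (μ.degree g) g with hc
  by_contra hne
  have hs : f - C c * g ≠ 0 := sub_ne_zero.mpr hne
  have hdeg := degree_eq_of_pderiv_mul_eq μ hs hg fun i => by
    rw [map_sub, pderiv_C_mul]
    linear_combination h i
  apply μ.coeff_degree_ne_zero_iff.mpr hs
  rw [hdeg, coeff_sub, coeff_C_mul, hc, div_mul_cancel₀ _ hg', sub_self]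

/-- The Jacobian determinant of a pair of polynomials in two variables. -/
noncomputable def jacobianPair (f g : MvPolynomial (Fin 2) R) : MvPolynomial (Fin 2) R :=
  pderiv 0 f * pderiv 1 g - pderiv 1 f * pderiv 0 g

theorem homogeneousComponent_jacobianPair {a b : ℕ} {f g : MvPolynomial (Fin 2) R}
    (hf : f.totalDegree ≤ a + 1) (hg : g.totalDegree ≤ b + 1) :
    homogeneousComponent (a + b) (jacobianPair f g) =
      jacobianPair (homogeneousComponent (a + 1) f) (homogeneousComponent (b + 1) g) := by
  simp only [jacobianPair, map_sub, ← homogeneousComponent_pderiv,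
    homogeneousComponent_mul_of_totalDegree_le (totalDegree_pderiv_le _ hf)
      (totalDegree_pderiv_le _ hg)]

theorem exists_eq_C_mul_pow_of_jacobianPair_eq_zero {K : Type*} [Field K] [CharZero K] {m e : ℕ}
    {f g : MvPolynomial (Fin 2) K} (he : e ≠ 0) (hm : m ≠ 0) (hf : f.IsHomogeneous (m * e))
    (hg : g.IsHomogeneous e) (hg0 : g ≠ 0) (h : jacobianPair f g = 0) :
    ∃ c : K, f = C c * g ^ m := by
  have hEf := hf.sum_X_mul_pderiv
  have hEg := hg.sum_X_mul_pderiv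
  simp only [Fin.sum_univ_two, nsmul_eq_mul, Nat.cast_mul] at hEf hEg
  have he' : (e : MvPolynomial (Fin 2) K) ≠ 0 := Nat.cast_ne_zero.mpr he
  refine exists_eq_C_mul_of_pderiv_mul_eq (pow_ne_zero m hg0) fun i => ?_
  suffices hi : pderiv i f * g = m * f * pderiv i g by
    obtain ⟨k, rfl⟩ := Nat.exists_eq_succ_of_ne_zero hm
    rw [pderiv_pow, Nat.succ_eq_add_one, Nat.add_sub_cancel, pow_succ]
    linear_combination g ^ k * hi
  apply mul_left_cancel₀ he'
  unfold jacobianPair at h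
  fin_cases i
  · simp only [Fin.zero_eta]
    linear_combination pderiv 0 g * hEf - pderiv 0 f * hEg + X 1 * h
  · simp only [Fin.mk_one]
    linear_combination pderiv 1 g * hEf - pderiv 1 f * hEg - X 0 * h

end MvPolynomial

theorem IsPolyAut.isUnit_jacobianPair {P Q : MvPolynomial (Fin 2) ℂ} (h : IsPolyAut P Q) :
    IsUnit (jacobianPair P Q) := by
  obtain ⟨P', Q', h, -⟩ := h
  have key (S : MvPolynomial (Fin 2) ℂ) (v : Fin 2 → ℂ) :
      eval v (bind₁ ![P, Q] S) = eval ![eval v P, eval v Q] S := by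
    change eval₂Hom (RingHom.id ℂ) v _ = eval₂Hom (RingHom.id ℂ) _ S
    rw [eval₂Hom_bind₁]
    congr 2
    ext i
    fin_cases i <;> rfl
  have h0 : bind₁ ![P, Q] P' = X 0 := MvPolynomial.funext fun v => by
    rw [key, (h v).1, eval_X]
  have h1 : bind₁ ![P, Q] Q' = X 1 := MvPolynomial.funext fun v => by
    rw [key, (h v).2, eval_X]
  have d00 := congrArg (pderiv 0) h0
  have d01 := congrArg (pderiv 1) h0
  have d10 := congrArg (pderiv 0) h1
  have d11 := congrArg (pderiv 1) h1
  simp only [pderiv_bind₁, Fin.sum_univ_two, Matrix.cons_val_zero, Matrix.cons_val_one,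
    pderiv_X_self, pderiv_X_of_ne zero_ne_one, pderiv_X_of_ne one_ne_zero] at d00 d01 d10 d11
  refine IsUnit.of_mul_eq_one (bind₁ ![P, Q] (jacobianPair P' Q')) ?_
  simp only [jacobianPair, map_sub, map_mul]
  generalize bind₁ ![P, Q] (pderiv 0 P') = a at *
  generalize bind₁ ![P, Q] (pderiv 1 P') = b at *
  generalize bind₁ ![P, Q] (pderiv 0 Q') = c at *
  generalize bind₁ ![P, Q] (pderiv 1 Q') = d at *
  linear_combination (c * pderiv 1 P + d * pderiv 1 Q) * d00 + d11 -
    (c * pderiv 0 P + d * pderiv 0 Q) * d01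

/-- If `F = (P, Q)` is a polynomial automorphism of ℂ² with `deg P > 1` and
`deg P = m · deg Q` for a positive integer `m`, then there is a constant `c ∈ ℂ`
with `deg (P − c·Qᵐ) < deg P`. -/
theorem degree_drop_of_aut (P Q : MvPolynomial (Fin 2) ℂ) (m : ℕ)
    (h : IsPolyAut P Q) (hP : 1 < P.totalDegree) (hm : 0 < m)
    (hdiv : P.totalDegree = m * Q.totalDegree) :
    ∃ c : ℂ, (P - C c * Q ^ m).totalDegree < P.totalDegree := by
  set d := P.totalDegree with hd
  set e := Q.totalDegree with he
  have he0 : 0 < e := Nat.pos_of_ne_zero fun h0 => by simp [h0] at hdiv; omega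
  obtain ⟨r, -, hr⟩ := isUnit_iff_eq_C_of_isReduced.mp h.isUnit_jacobianPair
  have hJ : jacobianPair (homogeneousComponent d P) (homogeneousComponent e Q) = 0 := by
    obtain ⟨a, ha⟩ : ∃ a, d = a + 1 := ⟨d - 1, by omega⟩
    obtain ⟨b, hb⟩ : ∃ b, e = b + 1 := ⟨e - 1, by omega⟩
    rw [ha, hb, ← homogeneousComponent_jacobianPair (by omega) (by omega), hr]
    apply homogeneousComponent_eq_zero
    rw [totalDegree_C]
    omega
  obtain ⟨c, hc⟩ := exists_eq_C_mul_pow_of_jacobianPair_eq_zero he0.ne' hm.ne'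
    (hdiv ▸ homogeneousComponent_isHomogeneous d P) (homogeneousComponent_isHomogeneous e Q)
    (homogeneousComponent_totalDegree_ne_zero he0) hJ
  refine ⟨c, totalDegree_lt_of_homogeneousComponent_eq_zero (by omega) ?_ ?_⟩
  · refine (totalDegree_sub _ _).trans (max_le le_rfl ?_)
    refine (totalDegree_mul _ _).trans ?_
    rw [totalDegree_C, zero_add, hdiv]
    exact totalDegree_pow Q m
  · rw [map_sub, homogeneousComponent_C_mul, hc, hdiv,
      homogeneousComponent_pow_of_totalDegree_le le_rfl, sub_self]
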